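/- arXiv:2101.12274 — 6 statements merged into one kernel-verified Lean document; each statement's English description precedes it below -/
import Mathlib

section
/- There exist absolute constants c, C > 0 such that for every κ ≥ 1 and every ξ ∈ 2πℤ, the series ∑_{η ∈ 2πℤ} 1/(√(κ²+η²)·√(κ²+(η+ξ)²)) converges and c·log(4+ξ²/κ²)/√(4κ²+ξ²) ≤ ∑_{η ∈ 2πℤ} 1/(√(κ²+η²)·√(κ²+(η+ξ)²)) ≤ C·log(4+ξ²/κ²)/√(4κ²+ξ²). -/
/-- The telescoping function `x ↦ log (1 + S / x)` decreases over a step `h` at most by `S h` times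
the value of `1 / (x (x + S))` at the left endpoint. -/
theorem log_one_add_div_sub_le {x h S : ℝ} (hx : 0 < x) (hh : 0 < h) (hS : 0 < S) :
    Real.log (1 + S / x) - Real.log (1 + S / (x + h)) ≤ S * h * (1 / (x * (x + S))) := by
  rw [← Real.log_div (by positivity) (by positivity)]
  refine (Real.log_le_sub_one_of_pos (by positivity)).trans ?_
  have : (1 + S / x) / (1 + S / (x + h)) - 1 = S * h * (1 / (x * (x + h + S))) := by
    field_simp
    ring
  rw [this]
  gcongr
  linarith

theorem le_log_one_add_div_sub {x h S : ℝ} (hx : 1 ≤ x) (hh : 0 < h) (hS : 0 < S) :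
    S * h * (1 / (x * (x + S))) ≤
      (1 + h) * (Real.log (1 + S / x) - Real.log (1 + S / (x + h))) := by
  have hx0 : 0 < x := by linarith
  rw [← Real.log_div (by positivity) (by positivity), ← div_le_iff₀' (by positivity)]
  refine le_trans ?_ (Real.one_sub_inv_le_log_of_pos (by positivity))
  have : 1 - ((1 + S / x) / (1 + S / (x + h)))⁻¹ = S * h / ((x + h) * (x + S)) := by
    field_simp
    ring
  rw [this, mul_one_div, div_div]
  apply div_le_div_of_nonneg_left (by positivity) (by positivity)
  nlinarith [mul_nonneg (mul_nonneg hh.le (sub_nonneg.2 hx)) (add_pos hx0 hS).le]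

theorem summable_one_div_mul_add_arith {κ h S : ℝ} (hκ : 1 ≤ κ) (hh : 0 < h) (hS : 0 < S) :
    Summable (fun n : ℕ => 1 / ((κ + h * n) * (κ + h * n + S))) ∧
    Real.log (1 + S / κ) / (S * h) ≤ ∑' n : ℕ, 1 / ((κ + h * n) * (κ + h * n + S)) ∧
    ∑' n : ℕ, 1 / ((κ + h * n) * (κ + h * n + S)) ≤ (1 + h) * Real.log (1 + S / κ) / (S * h) := by
  set F : ℕ → ℝ := fun n => 1 / ((κ + h * n) * (κ + h * n + S)) with hF
  set G : ℕ → ℝ := fun n => Real.log (1 + S / (κ + h * n)) with hG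
  have hκ0 : 0 < κ := by linarith
  have hSh : 0 < S * h := by positivity
  have hF0 : ∀ n, 0 ≤ F n := fun n => by positivity
  have hG0 : ∀ n, 0 ≤ G n := fun n => Real.log_nonneg (le_add_of_nonneg_right (by positivity))
  have hG_zero : G 0 = Real.log (1 + S / κ) := by simp [hG]
  have hstep (n : ℕ) : κ + h * (n + 1 : ℕ) = κ + h * n + h := by push_cast; ring
  have hupper (N : ℕ) : ∑ n ∈ Finset.range N, F n ≤ (1 + h) * G 0 / (S * h) := by
    rw [le_div_iff₀' hSh, Finset.mul_sum]
    calc ∑ n ∈ Finset.range N, S * h * F n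
        ≤ ∑ n ∈ Finset.range N, (1 + h) * (G n - G (n + 1)) := by
          refine Finset.sum_le_sum fun n _ => ?_
          simp only [hF, hG, hstep]
          exact le_log_one_add_div_sub (le_add_of_le_of_nonneg hκ (by positivity)) hh hS
      _ = (1 + h) * (G 0 - G N) := by rw [← Finset.mul_sum, Finset.sum_range_sub']
      _ ≤ (1 + h) * G 0 := by
          gcongr
          linarith [hG0 N]
  have hsum : Summable F := summable_of_sum_range_le hF0 hupper
  have hlower (N : ℕ) : G 0 - G N ≤ S * h * ∑' n, F n :=
    calc G 0 - G N = ∑ n ∈ Finset.range N, (G n - G (n + 1)) := (Finset.sum_range_sub' G N).symm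
      _ ≤ ∑ n ∈ Finset.range N, S * h * F n := by
          refine Finset.sum_le_sum fun n _ => ?_
          simp only [hF, hG, hstep]
          exact log_one_add_div_sub_le (by positivity) hh hS
      _ = S * h * ∑ n ∈ Finset.range N, F n := by rw [Finset.mul_sum]
      _ ≤ S * h * ∑' n, F n := by
          gcongr
          exact hsum.sum_le_tsum _ fun n _ => hF0 n
  have hlim : Filter.Tendsto G Filter.atTop (nhds 0) := by
    have h1 : Filter.Tendsto (fun n : ℕ => κ + h * (n : ℝ)) Filter.atTop Filter.atTop :=
      Filter.tendsto_atTop_add_const_left _ _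
        (tendsto_natCast_atTop_atTop.const_mul_atTop hh)
    have h2 := (h1.const_div_atTop S).const_add 1
    rw [add_zero] at h2
    simpa using h2.log one_ne_zero
  rw [← hG_zero]
  refine ⟨hsum, ?_, Real.tsum_le_of_sum_range_le hF0 hupper⟩
  rw [div_le_iff₀' hSh]
  refine le_of_tendsto' (f := fun N => G 0 - G N) (x := Filter.atTop) ?_ hlower
  simpa using hlim.const_sub (G 0)

theorem summable_one_div_mul_add_abs {κ h S : ℝ} (hκ : 1 ≤ κ) (hh : 0 < h) (hS : 0 < S) :
    Summable (fun n : ℤ => 1 / ((κ + |h * n|) * (κ + |h * n| + S))) ∧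
    Real.log (1 + S / κ) / (S * h) ≤ ∑' n : ℤ, 1 / ((κ + |h * n|) * (κ + |h * n| + S)) ∧
    ∑' n : ℤ, 1 / ((κ + |h * n|) * (κ + |h * n| + S)) ≤
      2 * ((1 + h) * Real.log (1 + S / κ) / (S * h)) := by
  obtain ⟨hsum, hlow, hupp⟩ := summable_one_div_mul_add_arith hκ hh hS
  have hκ0 : 0 < κ := by linarith
  have h0 := hsum.le_tsum 0 fun n _ => by positivity
  have hpos : 0 ≤ 1 / ((κ + h * (0 : ℕ)) * (κ + h * (0 : ℕ) + S)) := by positivity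
  have habs (n : ℕ) : |h * n| = h * n := abs_of_nonneg (by positivity)
  have hZ := HasSum.of_nat_of_neg
    (f := fun n : ℤ => 1 / ((κ + |h * n|) * (κ + |h * n| + S)))
    (by simpa [habs] using hsum.hasSum) (by simpa [habs] using hsum.hasSum)
  refine ⟨hZ.summable, ?_, ?_⟩ <;> rw [hZ.tsum_eq] <;> simp at * <;> linarith

theorem sqrt_sq_add_sq_le {a x : ℝ} (ha : 0 ≤ a) : √(a ^ 2 + x ^ 2) ≤ a + |x| := by
  refine Real.sqrt_le_iff.2 ⟨by positivity, ?_⟩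
  nlinarith [sq_abs x, mul_nonneg ha (abs_nonneg x)]

theorem add_abs_le_two_mul_sqrt (a x : ℝ) : a + |x| ≤ 2 * √(a ^ 2 + x ^ 2) := by
  have h1 : a ≤ √(a ^ 2 + x ^ 2) := Real.le_sqrt_of_sq_le (by nlinarith [sq_nonneg x])
  have h2 : |x| ≤ √(a ^ 2 + x ^ 2) := Real.abs_le_sqrt (by nlinarith [sq_nonneg a])
  linarith

theorem one_div_mul_add_le_kernel {κ : ℝ} (hκ : 0 < κ) (x y : ℝ) :
    1 / ((κ + |x|) * (κ + |x| + (2 * κ + |y|))) ≤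
      1 / (√(κ ^ 2 + x ^ 2) * √(κ ^ 2 + (x + y) ^ 2)) := by
  have h := abs_add_le x y
  gcongr
  · exact sqrt_sq_add_sq_le hκ.le
  · exact (sqrt_sq_add_sq_le hκ.le).trans (by linarith)

theorem kernel_le_one_div_mul_add {κ : ℝ} (hκ : 0 < κ) (x y : ℝ) :
    1 / (√(κ ^ 2 + x ^ 2) * √(κ ^ 2 + (x + y) ^ 2)) ≤
      16 * (1 / ((κ + |x|) * (κ + |x| + (2 * κ + |y|))) +
        1 / ((κ + |x + y|) * (κ + |x + y| + (2 * κ + |y|)))) := by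
  have hA := add_abs_le_two_mul_sqrt κ x
  have hB := add_abs_le_two_mul_sqrt κ (x + y)
  have hAB : |y| ≤ |x| + |x + y| := by
    calc |y| = |(x + y) - x| := by ring_nf
      _ ≤ |x + y| + |x| := abs_sub _ _
      _ = _ := add_comm _ _
  set A := κ + |x| with hA'
  set B := κ + |x + y| with hB'
  set S := 2 * κ + |y| with hS'
  have hA0 : 0 < A := by positivity
  have hB0 : 0 < B := by positivity
  have hS0 : 0 < S := by positivity
  have hSAB : S ≤ A + B := by linarith
  have key {a b : ℝ} (ha : 0 < a) (hab : a ≤ b) (hS : S ≤ a + b) :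
      1 / (a / 2 * (b / 2)) ≤ 16 * (1 / (a * (a + S))) := by
    have hb : 0 < b := by linarith
    rw [mul_one_div, div_le_div_iff₀ (by positivity) (by positivity)]
    nlinarith [mul_nonneg ha.le (show 0 ≤ 4 * b - (a + S) by linarith)]
  have hle : 1 / (√(κ ^ 2 + x ^ 2) * √(κ ^ 2 + (x + y) ^ 2)) ≤ 1 / (A / 2 * (B / 2)) := by
    gcongr <;> linarith
  have hpA : 0 ≤ 1 / (A * (A + S)) := by positivity
  have hpB : 0 ≤ 1 / (B * (B + S)) := by positivity
  rcases le_total A B with h | h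
  · linarith [key hA0 h hSAB]
  · have := key hB0 h (by linarith)
    rw [mul_comm (B / 2)] at this
    linarith

theorem log_one_add_div_bounds {κ : ℝ} (hκ : 0 < κ) (y : ℝ) :
    Real.log (4 + y ^ 2 / κ ^ 2) ≤ 2 * Real.log (1 + (2 * κ + |y|) / κ) ∧
    Real.log (1 + (2 * κ + |y|) / κ) ≤ 2 * Real.log (4 + y ^ 2 / κ ^ 2) := by
  have h1 : 1 + (2 * κ + |y|) / κ = 3 + |y| / κ := by field_simp; ring
  have h2 : y ^ 2 / κ ^ 2 = (|y| / κ) ^ 2 := by rw [div_pow, sq_abs]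
  have ht : 0 ≤ |y| / κ := by positivity
  rw [h1, h2]
  generalize |y| / κ = t at ht
  constructor
  · have h : Real.log ((3 + t) ^ 2) = 2 * Real.log (3 + t) := by simp
    rw [← h]
    exact Real.log_le_log (by positivity) (by nlinarith)
  · have h : Real.log ((4 + t ^ 2) ^ 2) = 2 * Real.log (4 + t ^ 2) := by simp
    rw [← h]
    exact Real.log_le_log (by positivity) (by nlinarith [sq_nonneg (t - 1), sq_nonneg (t ^ 2)])

/-- Lemma 2.1 of the paper (torus case), on the Fourier side.  The sum over
`η ∈ 2πℤ` is realized as a sum over `n : ℤ` with `η = 2πn`, and `ξ = 2πm`. -/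
theorem hilbert_schmidt_kernel_sum_torus :
    ∃ c C : ℝ, 0 < c ∧ 0 < C ∧
      ∀ κ : ℝ, 1 ≤ κ → ∀ m : ℤ,
        Summable (fun n : ℤ =>
          1 / (Real.sqrt (κ ^ 2 + (2 * Real.pi * n) ^ 2) *
            Real.sqrt (κ ^ 2 + (2 * Real.pi * n + 2 * Real.pi * m) ^ 2))) ∧
        c * Real.log (4 + (2 * Real.pi * m) ^ 2 / κ ^ 2) /
            Real.sqrt (4 * κ ^ 2 + (2 * Real.pi * m) ^ 2) ≤
          (∑' n : ℤ, 1 / (Real.sqrt (κ ^ 2 + (2 * Real.pi * n) ^ 2) *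
            Real.sqrt (κ ^ 2 + (2 * Real.pi * n + 2 * Real.pi * m) ^ 2))) ∧
        (∑' n : ℤ, 1 / (Real.sqrt (κ ^ 2 + (2 * Real.pi * n) ^ 2) *
            Real.sqrt (κ ^ 2 + (2 * Real.pi * n + 2 * Real.pi * m) ^ 2))) ≤
          C * Real.log (4 + (2 * Real.pi * m) ^ 2 / κ ^ 2) /
            Real.sqrt (4 * κ ^ 2 + (2 * Real.pi * m) ^ 2) := by

  have hh : 0 < 2 * Real.pi := by positivity
  refine ⟨1 / (2 * Real.pi) / 4, 128 * ((1 + 2 * Real.pi) / (2 * Real.pi)),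
    by positivity, by positivity, fun κ hκ m => ?_⟩
  have hκ0 : 0 < κ := by linarith
  set h := 2 * Real.pi with hh_def
  set S := 2 * κ + |h * m| with hS_def
  have hS : 0 < S := by positivity
  obtain ⟨hsum, hlow, hupp⟩ := summable_one_div_mul_add_abs hκ hh hS
  set f : ℤ → ℝ := fun n => 1 / ((κ + |h * n|) * (κ + |h * n| + S)) with hf
  set t : ℤ → ℝ := fun n =>
    1 / (√(κ ^ 2 + (h * n) ^ 2) * √(κ ^ 2 + (h * n + h * m) ^ 2)) with ht
  have hshift : Summable fun n => f (n + m) := (Equiv.addRight m).summable_iff.2 hsum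
  have hshift_tsum : ∑' n, f (n + m) = ∑' n, f n := (Equiv.addRight m).tsum_eq f
  have hft (n : ℤ) : f n ≤ t n := one_div_mul_add_le_kernel hκ0 _ _
  have htf (n : ℤ) : t n ≤ 16 * (f n + f (n + m)) := by
    simp only [hf, ht, Int.cast_add, mul_add h]
    exact kernel_le_one_div_mul_add hκ0 (h * n) (h * m)
  have hsum' : Summable fun n => 16 * (f n + f (n + m)) := (hsum.add hshift).mul_left 16
  have hts : Summable t := Summable.of_nonneg_of_le (fun n => by positivity) htf hsum'
  have hft' : ∑' n, f n ≤ ∑' n, t n := hsum.tsum_le_tsum hft hts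
  have htf' : ∑' n, t n ≤ 32 * ∑' n, f n := by
    refine (hts.tsum_le_tsum htf hsum').trans_eq ?_
    rw [tsum_mul_left, hsum.tsum_add hshift, hshift_tsum]
    ring
  obtain ⟨hlog1, hlog2⟩ := log_one_add_div_bounds hκ0 (h * m)
  have hlog0 : 0 ≤ Real.log (4 + (h * m) ^ 2 / κ ^ 2) :=
    Real.log_nonneg (by linarith [show 0 ≤ (h * m) ^ 2 / κ ^ 2 by positivity])
  have hsq : 4 * κ ^ 2 = (2 * κ) ^ 2 := by ring
  have hR1 := sqrt_sq_add_sq_le (a := 2 * κ) (x := h * m) (by positivity)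
  have hR2 := add_abs_le_two_mul_sqrt (2 * κ) (h * m)
  rw [← hsq, ← hS_def] at hR1 hR2
  have hR0 : 0 < √(4 * κ ^ 2 + (h * m) ^ 2) := by positivity
  refine ⟨hts, le_trans ?_ (hlow.trans hft'), htf'.trans ?_⟩
  · generalize Real.log (4 + (h * m) ^ 2 / κ ^ 2) = ℓ at *
    calc 1 / h / 4 * ℓ / √(4 * κ ^ 2 + (h * m) ^ 2)
        ≤ 1 / h / 4 * ℓ / (S / 2) := by
          gcongr
          linarith
      _ = ℓ / 2 / (S * h) := by field_simp; ring
      _ ≤ _ := by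
          gcongr
          linarith
  · calc 32 * ∑' n, f n ≤ 32 * (2 * ((1 + h) * Real.log (1 + S / κ) / (S * h))) := by gcongr
      _ ≤ 32 * (2 * ((1 + h) * (2 * Real.log (4 + (h * m) ^ 2 / κ ^ 2)) / (S * h))) := by gcongr
      _ = 128 * ((1 + h) / h) * Real.log (4 + (h * m) ^ 2 / κ ^ 2) / S := by field_simp; ring
      _ ≤ _ := div_le_div_of_nonneg_left (by positivity) hR0 hR1
end

section
/- For every κ > 0 and every ξ ∈ 2πℤ, the series ∑_{η ∈ 2πℤ} (1/(η−iκ) − 1/(η+ξ+iκ)) of complex numbers converges absolutely and its sum equals i·(1+e^{−κ})/(1−e^{−κ}). -/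
/-- The telescoping series `∑ (1 / (z + n) - 1 / (z + n + m))` over `n ∈ ℤ` sums to zero. -/
lemma hasSum_one_div_add_int_sub_one_div_add_int_add (z : UpperHalfPlane) (m : ℤ) :
    HasSum (fun n : ℤ => 1 / ((z : ℂ) + n) - 1 / ((z : ℂ) + n + m)) 0 := by
  have step : HasSum (fun n : ℤ => 1 / ((z : ℂ) + n) - 1 / ((z : ℂ) + n + 1)) 0 := by
    have hs := EisensteinSeries.summable_right_one_div_linear_sub_one_div_linear_succ z 1
    have ht := EisensteinSeries.tsum_symmetricIco_linear_sub_linear_add_one_eq_zero z 1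
    rw [tsum_eq_of_summable_unconditional hs] at ht
    have h := hs.hasSum
    rw [ht] at h
    simpa only [Int.cast_one, one_mul] using h
  have shift (k : ℤ) : HasSum (fun n : ℤ =>
      1 / ((z : ℂ) + n + k) - 1 / ((z : ℂ) + n + (k + 1 : ℤ))) 0 := by
    refine ((Equiv.addRight k).hasSum_iff.mpr step).congr_fun ?_
    intro n
    simp [add_assoc]
  induction m using Int.induction_on with
  | zero => simp
  | succ k ih => simpa using ih.add (shift k)
  | pred k ih => simpa using ih.sub (shift (-k - 1))

/-- The Mittag-Leffler expansion of the cotangent as a series over all integers. -/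
lemma hasSum_int_cot {x : ℂ} (hx : x ∈ Complex.integerComplement) :
    HasSum (fun n : ℤ => 1 / (x - n) + 1 / (x + n)) (2 * (Real.pi * Complex.cot (Real.pi * x))) := by
  have h : HasSum (fun n : ℕ => 1 / (x - (n + 1)) + 1 / (x + (n + 1)))
      (Real.pi * Complex.cot (Real.pi * x) - 1 / x) :=
    cot_series_rep' hx ▸ (summable_cotTerm hx).hasSum
  convert HasSum.of_add_one_of_neg_add_one (f := fun n : ℤ => 1 / (x - n) + 1 / (x + n))
    (m := Real.pi * Complex.cot (Real.pi * x) - 1 / x)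
    (m' := Real.pi * Complex.cot (Real.pi * x) - 1 / x) ?_ ?_ using 1
  · simp
    ring
  · simpa using h
  · refine h.congr_fun fun n => ?_
    push_cast
    ring

/-- The key summation identity in the torus case of Lemma 2.2 of the paper:
for `ξ = 2πm ∈ 2πℤ`, the sum over `η = 2πn ∈ 2πℤ` of
`1/(η − iκ) − 1/(η + ξ + iκ)` converges absolutely to `i(1+e^{−κ})/(1−e^{−κ})`. -/
theorem cotangent_sum_identity (κ : ℝ) (hκ : 0 < κ) (m : ℤ) :
    Summable (fun n : ℤ =>
      ‖(1 / ((2 * Real.pi * n : ℝ) - Complex.I * (κ : ℂ)) -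
        1 / ((2 * Real.pi * n : ℝ) + (2 * Real.pi * m : ℝ) + Complex.I * (κ : ℂ)))‖) ∧
    (∑' n : ℤ,
      (1 / ((2 * Real.pi * n : ℝ) - Complex.I * (κ : ℂ)) -
        1 / ((2 * Real.pi * n : ℝ) + (2 * Real.pi * m : ℝ) + Complex.I * (κ : ℂ))))
      = Complex.I * ((1 + Real.exp (-κ) : ℝ) : ℂ) / ((1 - Real.exp (-κ) : ℝ) : ℂ) := by
  have him : 0 < (Complex.I * κ / (2 * Real.pi)).im := by
    rw [show Complex.I * κ / (2 * Real.pi) = ((κ / (2 * Real.pi) : ℝ) : ℂ) * Complex.I by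
      push_cast; ring]
    rw [Complex.im_ofReal_mul, Complex.I_im, mul_one]
    positivity
  let z : UpperHalfPlane := ⟨Complex.I * κ / (2 * Real.pi), him⟩
  have hz : Complex.I * κ = 2 * Real.pi * (z : ℂ) := by
    change _ = 2 * Real.pi * (Complex.I * κ / (2 * Real.pi))
    field_simp
  have hexp : Complex.exp (2 * Real.pi * Complex.I * z) = Complex.exp (-κ) := by
    congr 1
    linear_combination -Complex.I * hz + (κ : ℂ) * Complex.I_sq
  have hne : (1 : ℂ) - Complex.exp (-κ) ≠ 0 := by
    have : 1 - Real.exp (-κ) ≠ 0 := by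
      have : Real.exp (-κ) < 1 := by simpa using hκ
      linarith
    exact_mod_cast this
  have hsum := ((hasSum_one_div_add_int_sub_one_div_add_int_add z m).sub
    (hasSum_int_cot z.coe_mem_integerComplement)).mul_left (1 / (2 * Real.pi : ℂ))
  have key : HasSum (fun n : ℤ =>
      (1 / ((2 * Real.pi * n : ℝ) - Complex.I * (κ : ℂ)) -
        1 / ((2 * Real.pi * n : ℝ) + (2 * Real.pi * m : ℝ) + Complex.I * (κ : ℂ))))
      (Complex.I * ((1 + Real.exp (-κ) : ℝ) : ℂ) / ((1 - Real.exp (-κ) : ℝ) : ℂ)) := by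
    have hval : 1 / (2 * Real.pi : ℂ) * (0 - 2 * (Real.pi * Complex.cot (Real.pi * z))) =
        Complex.I * ((1 + Real.exp (-κ) : ℝ) : ℂ) / ((1 - Real.exp (-κ) : ℝ) : ℂ) := by
      rw [Complex.cot_pi_eq_exp_ratio, hexp]
      push_cast
      field_simp
      linear_combination -2 * Real.pi * (1 + Complex.exp (-κ)) * Complex.I_sq
    rw [← hval]
    refine hsum.congr_fun fun n => ?_
    rw [hz, show ((2 * Real.pi * n : ℝ) : ℂ) - 2 * Real.pi * z = -(2 * Real.pi * (z - n)) by
      push_cast; ring, show ((2 * Real.pi * n : ℝ) : ℂ) + (2 * Real.pi * m : ℝ) +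
      2 * Real.pi * z = 2 * Real.pi * (z + n + m) by push_cast; ring]
    simp only [one_div, inv_neg, mul_inv]
    ring
  exact ⟨key.summable.norm, key.tsum_eq⟩
end

section
/- Let κ > 0 and let η₁, η₂, η₃, η₄ be real numbers with η₁+η₂+η₃+η₄ = 0. Then the function ξ ↦ 1/((κ+iξ)(κ−i(ξ+η₁))(κ+i(ξ+η₁+η₂))(κ−i(ξ+η₁+η₂+η₃))) is integrable on ℝ and (1/2π)·∫_ℝ dξ/((κ+iξ)(κ−i(ξ+η₁))(κ+i(ξ+η₁+η₂))(κ−i(ξ+η₁+η₂+η₃))) = (4κ−i(η₁+η₃))/((2κ−iη₁)(2κ+iη₂)(2κ−iη₃)(2κ+iη₄)). -/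
open MeasureTheory

section LinearFactors

open Filter Topology Complex

/-- The complex logarithm along a ray, renormalised by the real logarithm. -/
lemma tendsto_log_mul_add_sub_log {w : ℂ} (hw : w ∈ slitPlane) (p : ℂ) :
    Tendsto (fun t : ℝ => log (w * t + p) - (Real.log t : ℂ)) atTop (𝓝 (log w)) := by
  have hinv : Tendsto (fun t : ℝ => ((t⁻¹ : ℝ) : ℂ)) atTop (𝓝 0) := 
    (continuous_ofReal.tendsto' 0 0 ofReal_zero).comp tendsto_inv_atTop_zero
  have h1 : Tendsto (fun t : ℝ => w + p * ((t⁻¹ : ℝ) : ℂ)) atTop (𝓝 w) := by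
    simpa using (hinv.const_mul p).const_add w
  have h2 := h1.clog hw
  refine h2.congr' ?_
  have h3 := h1.eventually_ne (slitPlane_ne_zero hw)
  filter_upwards [eventually_gt_atTop 0, h3] with t ht hne
  have ht' : (t : ℂ) ≠ 0 := by exact_mod_cast ht.ne'
  have : w * t + p = t * (w + p * ((t⁻¹ : ℝ) : ℂ)) := by
    push_cast
    field_simp
  rw [this, log_ofReal_mul ht hne]
  ring

lemma mul_I_mul_add_mem_slitPlane {p : ℂ} (hp : 0 < p.re) (s x : ℝ) :
    s * I * x + p ∈ slitPlane := by
  left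
  simpa using hp

lemma mul_I_mul_add_ne_zero {p : ℂ} (hp : 0 < p.re) (s x : ℝ) :
    s * I * x + p ≠ 0 :=
  slitPlane_ne_zero (mul_I_mul_add_mem_slitPlane hp s x)

lemma hasDerivAt_mul_I_mul_add (p : ℂ) (s x : ℝ) :
    HasDerivAt (fun x : ℝ => s * I * (x : ℂ) + p) (s * I) x := by
  simpa using ((hasDerivAt_id x).ofReal_comp.const_mul ((s : ℂ) * I)).add_const p

lemma memLp_two_inv_mul_I_mul_add {p : ℂ} (hp : 0 < p.re) {s : ℝ} (hs : s ≠ 0) :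
    MemLp (fun x : ℝ => (s * I * (x : ℂ) + p)⁻¹) 2 := by
  have hc : Continuous fun x : ℝ => (s * I * (x : ℂ) + p)⁻¹ :=
    Continuous.inv₀ (by fun_prop) fun x => mul_I_mul_add_ne_zero hp s x
  rw [memLp_two_iff_integrable_sq_norm hc.aestronglyMeasurable]
  have h := (((integrable_inv_one_add_sq.comp_add_right (p.im / p.re)).comp_mul_left'
    (div_ne_zero hs hp.ne')).const_mul (p.re ^ 2)⁻¹)
  refine h.congr (Eventually.of_forall fun x => ?_)
  have hn : ‖s * I * (x : ℂ) + p‖ ^ 2 = p.re ^ 2 + (s * x + p.im) ^ 2 := by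
    rw [← normSq_eq_norm_sq, normSq_apply]
    simp
    ring
  simp only [norm_inv, inv_pow]
  rw [hn, ← mul_inv]
  congr 1
  field_simp

lemma integrable_inv_mul_inv {p q : ℂ} (hp : 0 < p.re) (hq : 0 < q.re) {s t : ℝ}
    (hs : s ≠ 0) (ht : t ≠ 0) :
    Integrable fun x : ℝ => (s * I * (x : ℂ) + p)⁻¹ * (t * I * (x : ℂ) + q)⁻¹ :=
  (memLp_two_inv_mul_I_mul_add hp hs).integrable_mul (memLp_two_inv_mul_I_mul_add hq ht)

lemma ofReal_mul_I_mem_slitPlane {s : ℝ} (hs : s ≠ 0) : (s : ℂ) * I ∈ slitPlane := by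
  right
  simpa using hs

lemma tendsto_log_sub_log (p q : ℂ) {s t : ℝ} (hs : s ≠ 0) (ht : t ≠ 0) :
    Tendsto (fun x : ℝ => log (s * I * x + p) - log (t * I * x + q)) atTop
      (𝓝 (log (s * I) - log (t * I))) := by
  have h := (tendsto_log_mul_add_sub_log (ofReal_mul_I_mem_slitPlane hs) p).sub
    (tendsto_log_mul_add_sub_log (ofReal_mul_I_mem_slitPlane ht) q)
  simpa using h

lemma integral_inv_mul_inv_eq_log {p q : ℂ} (hp : 0 < p.re) (hq : 0 < q.re) {s t : ℝ}
    (hs : s ≠ 0) (ht : t ≠ 0) :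
    (s * I * q - t * I * p) *
        ∫ x : ℝ, (s * I * (x : ℂ) + p)⁻¹ * (t * I * (x : ℂ) + q)⁻¹
      = (log (s * I) - log (t * I)) -
        (log ((-s : ℝ) * I) - log ((-t : ℝ) * I)) := by
  rw [← integral_const_mul]
  refine integral_of_hasDerivAt_of_tendsto
    (f := fun x : ℝ => log (s * I * x + p) - log (t * I * x + q)) (fun x => ?_)
    ((integrable_inv_mul_inv hp hq hs ht).const_mul _) ?_ (tendsto_log_sub_log p q hs ht)
  · refine (((hasDerivAt_mul_I_mul_add p s x).clog_real
      (mul_I_mul_add_mem_slitPlane hp s x)).sub ((hasDerivAt_mul_I_mul_add q t x).clog_real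
      (mul_I_mul_add_mem_slitPlane hq t x))).congr_deriv ?_
    have h1 := mul_I_mul_add_ne_zero hp s x
    have h2 := mul_I_mul_add_ne_zero hq t x
    have h3 : s * I * q - t * I * p = s * I * (t * I * x + q) - t * I * (s * I * x + p) := by
      ring
    rw [h3]
    generalize s * I * x + p = u at *
    generalize t * I * x + q = v at *
    field_simp
  · have h := (tendsto_log_sub_log p q (neg_ne_zero.2 hs) (neg_ne_zero.2 ht)).comp
      tendsto_neg_atBot_atTop
    refine h.congr fun x => ?_
    simp

/-- If both poles lie in the same half-plane, the integral vanishes. -/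
lemma integral_inv_mul_inv_same_side {p q : ℂ} (hp : 0 < p.re) (hq : 0 < q.re) {s : ℝ}
    (hs : s ≠ 0) :
    ∫ x : ℝ, (s * I * (x : ℂ) + p)⁻¹ * (s * I * (x : ℂ) + q)⁻¹ = 0 := by
  have hsI : (s : ℂ) * I ≠ 0 := slitPlane_ne_zero (ofReal_mul_I_mem_slitPlane hs)
  rcases eq_or_ne p q with rfl | hpq
  · have hlim : Tendsto (fun x : ℝ => -(s * I)⁻¹ * (s * I * (x : ℂ) + p)⁻¹)
        (Bornology.cobounded ℝ) (𝓝 0) := by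
      have hinv : Tendsto (fun x : ℝ => (s * I * (x : ℂ) + p)⁻¹) (Bornology.cobounded ℝ) (𝓝 0) := by
        refine tendsto_inv₀_cobounded.comp ?_
        refine (tendsto_add_const_cobounded p).comp ?_
        refine (tendsto_mul_left_cobounded hsI).comp ?_
        exact RCLike.tendsto_ofReal_cobounded_cobounded ℂ
      simpa using hinv.const_mul (-(s * I)⁻¹)
    refine (integral_of_hasDerivAt_of_tendsto (fun x => ?_)
      (integrable_inv_mul_inv hp hp hs hs) (hlim.mono_left IsOrderBornology.atBot_le_cobounded)
      (hlim.mono_left IsOrderBornology.atTop_le_cobounded)).trans (sub_zero 0)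
    have h1 := mul_I_mul_add_ne_zero hp s x
    refine (((hasDerivAt_mul_I_mul_add p s x).fun_inv h1).const_mul
      (-(s * I)⁻¹)).congr_deriv ?_
    generalize s * I * x + p = u at *
    field_simp
    exact div_self (ofReal_ne_zero.2 hs)
  · have h := integral_inv_mul_inv_eq_log hp hq hs hs
    simp only [sub_self] at h
    refine (mul_eq_zero.1 h).resolve_left ?_
    rw [← mul_sub]
    exact mul_ne_zero hsI (sub_ne_zero.2 hpq.symm)

/-- The residue computation for one pole in each half-plane. -/
lemma integral_inv_mul_inv_opposite_side {p q : ℂ} (hp : 0 < p.re) (hq : 0 < q.re) :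
    ∫ x : ℝ, (((1 : ℝ) : ℂ) * I * (x : ℂ) + p)⁻¹ * (((-1 : ℝ) : ℂ) * I * (x : ℂ) + q)⁻¹
      = 2 * Real.pi / (p + q) := by
  have h := integral_inv_mul_inv_eq_log hp hq one_ne_zero (neg_ne_zero.2 one_ne_zero)
  have hpq : p + q ≠ 0 := fun h0 => by
    have := congrArg re h0
    simp at this
    linarith
  rw [eq_div_iff hpq]
  refine mul_left_cancel₀ I_ne_zero ?_
  generalize (∫ x : ℝ, (((1 : ℝ) : ℂ) * I * (x : ℂ) + p)⁻¹ *
    (((-1 : ℝ) : ℂ) * I * (x : ℂ) + q)⁻¹) = J at h ⊢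
  simp only [ofReal_one, ofReal_neg, neg_neg, one_mul, neg_mul, log_I, log_neg_I] at h
  linear_combination h

end LinearFactors

/-- The contour-integral identity underlying the line case of Lemma 2.3 of the paper. -/
theorem quartic_contour_integral (κ : ℝ) (hκ : 0 < κ) (η₁ η₂ η₃ η₄ : ℝ)
    (hsum : η₁ + η₂ + η₃ + η₄ = 0) :
    Integrable (fun ξ : ℝ =>
      1 / (((κ : ℂ) + Complex.I * (ξ : ℂ)) *
        ((κ : ℂ) - Complex.I * ((ξ + η₁ : ℝ) : ℂ)) *
        ((κ : ℂ) + Complex.I * ((ξ + η₁ + η₂ : ℝ) : ℂ)) *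
        ((κ : ℂ) - Complex.I * ((ξ + η₁ + η₂ + η₃ : ℝ) : ℂ)))) ∧
    (1 / (2 * (Real.pi : ℂ))) *
        (∫ ξ : ℝ, 1 / (((κ : ℂ) + Complex.I * (ξ : ℂ)) *
          ((κ : ℂ) - Complex.I * ((ξ + η₁ : ℝ) : ℂ)) *
          ((κ : ℂ) + Complex.I * ((ξ + η₁ + η₂ : ℝ) : ℂ)) *
          ((κ : ℂ) - Complex.I * ((ξ + η₁ + η₂ + η₃ : ℝ) : ℂ))))
      = (4 * (κ : ℂ) - Complex.I * ((η₁ + η₃ : ℝ) : ℂ)) /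
          ((2 * (κ : ℂ) - Complex.I * (η₁ : ℂ)) * (2 * (κ : ℂ) + Complex.I * (η₂ : ℂ)) *
            (2 * (κ : ℂ) - Complex.I * (η₃ : ℂ)) * (2 * (κ : ℂ) + Complex.I * (η₄ : ℂ))) := by
  set a : ℂ := (κ : ℂ) with ha
  set b : ℂ := a - Complex.I * η₁ with hb
  set c : ℂ := a + Complex.I * ((η₁ + η₂ : ℝ) : ℂ) with hc
  set d : ℂ := a - Complex.I * ((η₁ + η₂ + η₃ : ℝ) : ℂ) with hd
  have hη : (η₄ : ℂ) = -(η₁ + η₂ + η₃) := by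
    rw [← add_eq_zero_iff_eq_neg, add_comm]
    have := congrArg (Complex.ofReal) hsum
    push_cast at this
    exact this
  have hare : 0 < a.re := by simpa [ha] using hκ
  have hbre : 0 < b.re := by simpa [hb, ha] using hκ
  have hcre : 0 < c.re := by simpa [hc, ha] using hκ
  have hdre : 0 < d.re := by simpa [hd, ha] using hκ
  have hne {p q : ℂ} (hp : 0 < p.re) (hq : 0 < q.re) : p + q ≠ 0 := fun h0 => by
    have := congrArg Complex.re h0
    simp at this
    linarith
  have hab := hne hare hbre
  have hcd := hne hcre hdre
  have had := hne hare hdre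
  have hcb := hne hcre hbre
  have h1 : (1 : ℝ) ≠ 0 := one_ne_zero
  have h2 : (-1 : ℝ) ≠ 0 := neg_ne_zero.2 h1
  let f (s : ℝ) (p : ℂ) (x : ℝ) : ℂ := (s * Complex.I * (x : ℂ) + p)⁻¹
  have hac_int : Integrable (fun x => f 1 a x * f 1 c x) :=
    integrable_inv_mul_inv hare hcre h1 h1
  have had_int : Integrable (fun x => f 1 a x * f (-1) d x) :=
    integrable_inv_mul_inv hare hdre h1 h2
  have hcb_int : Integrable (fun x => f 1 c x * f (-1) b x) :=
    integrable_inv_mul_inv hcre hbre h1 h2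
  have hbd_int : Integrable (fun x => f (-1) b x * f (-1) d x) :=
    integrable_inv_mul_inv hbre hdre h2 h2
  have hac : ∫ x, f 1 a x * f 1 c x = 0 := integral_inv_mul_inv_same_side hare hcre h1
  have hbd : ∫ x, f (-1) b x * f (-1) d x = 0 := integral_inv_mul_inv_same_side hbre hdre h2
  have had' : ∫ x, f 1 a x * f (-1) d x = 2 * Real.pi / (a + d) :=
    integral_inv_mul_inv_opposite_side hare hdre
  have hcb' : ∫ x, f 1 c x * f (-1) b x = 2 * Real.pi / (c + b) :=
    integral_inv_mul_inv_opposite_side hcre hbre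
  have key : (fun ξ : ℝ =>
      1 / ((a + Complex.I * (ξ : ℂ)) *
        (a - Complex.I * ((ξ + η₁ : ℝ) : ℂ)) *
        (a + Complex.I * ((ξ + η₁ + η₂ : ℝ) : ℂ)) *
        (a - Complex.I * ((ξ + η₁ + η₂ + η₃ : ℝ) : ℂ)))) =
      fun ξ => ((a + b) * (c + d))⁻¹ * (f 1 a ξ * f 1 c ξ + f 1 a ξ * f (-1) d ξ +
        f 1 c ξ * f (-1) b ξ + f (-1) b ξ * f (-1) d ξ) := by
    funext ξ
    have ea : a + Complex.I * (ξ : ℂ) = ((1 : ℝ) : ℂ) * Complex.I * ξ + a := by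
      push_cast; ring
    have eb : a - Complex.I * ((ξ + η₁ : ℝ) : ℂ) = ((-1 : ℝ) : ℂ) * Complex.I * ξ + b := by
      rw [hb]; push_cast; ring
    have ec : a + Complex.I * ((ξ + η₁ + η₂ : ℝ) : ℂ) =
        ((1 : ℝ) : ℂ) * Complex.I * ξ + c := by
      rw [hc]; push_cast; ring
    have ed : a - Complex.I * ((ξ + η₁ + η₂ + η₃ : ℝ) : ℂ) =
        ((-1 : ℝ) : ℂ) * Complex.I * ξ + d := by
      rw [hd]; push_cast; ring
    rw [ea, eb, ec, ed]
    have na := mul_I_mul_add_ne_zero hare 1 ξ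
    have nb := mul_I_mul_add_ne_zero hbre (-1) ξ
    have nc := mul_I_mul_add_ne_zero hcre 1 ξ
    have nd := mul_I_mul_add_ne_zero hdre (-1) ξ
    have sab : a + b = (((1 : ℝ) : ℂ) * Complex.I * ξ + a) +
        (((-1 : ℝ) : ℂ) * Complex.I * ξ + b) := by push_cast; ring
    have scd : c + d = (((1 : ℝ) : ℂ) * Complex.I * ξ + c) +
        (((-1 : ℝ) : ℂ) * Complex.I * ξ + d) := by push_cast; ring
    rw [sab] at hab ⊢
    rw [scd] at hcd ⊢
    simp only [f]
    generalize ((1 : ℝ) : ℂ) * Complex.I * ξ + a = A at *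
    generalize ((-1 : ℝ) : ℂ) * Complex.I * ξ + b = B at *
    generalize ((1 : ℝ) : ℂ) * Complex.I * ξ + c = C at *
    generalize ((-1 : ℝ) : ℂ) * Complex.I * ξ + d = D at *
    field_simp
    ring
  rw [key]
  refine ⟨(((hac_int.add had_int).add hcb_int).add hbd_int).const_mul _, ?_⟩
  rw [integral_const_mul, integral_add (by exact (hac_int.add had_int).add hcb_int) hbd_int,
    integral_add (by exact hac_int.add had_int) hcb_int, integral_add hac_int had_int,
    hac, hbd, had', hcb']
  have e1 : 2 * a - Complex.I * η₁ = a + b := by rw [hb]; ring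
  have e2 : 2 * a + Complex.I * η₂ = c + b := by rw [hb, hc]; push_cast; ring
  have e3 : 2 * a - Complex.I * η₃ = c + d := by rw [hc, hd]; push_cast; ring
  have e4 : 2 * a + Complex.I * η₄ = a + d := by rw [hd, hη]; push_cast; ring
  have e5 : 4 * a - Complex.I * ((η₁ + η₃ : ℝ) : ℂ) = (a + d) + (c + b) := by
    rw [hb, hc, hd]; push_cast; ring
  rw [e1, e2, e3, e4, e5]
  have hpi : (Real.pi : ℂ) ≠ 0 := by exact_mod_cast Real.pi_ne_zero
  field_simp
  ring
end

section
/- There is an absolute constant C such that the following holds. Let κ ≥ 1 and let q, f, g be Schwartz functions on ℝ. Define F and G to be the inverse Fourier transforms of ξ ↦ (κ²+ξ²)^{−1/8}·f̂(ξ) and ξ ↦ (κ²+ξ²)^{−1/8}·ĝ(ξ), respectively. Then |∫_ℝ conj(F(x))·q(x)·G(x) dx| ≤ C·‖q‖_{L²}·‖f‖_{L²}·‖g‖_{L²}. -/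
open MeasureTheory

/-- The Fourier transform with the paper's normalization
`f̂(ξ) = (2π)^{−1/2} ∫ e^{−iξx} f(x) dx`. -/
noncomputable def ft (f : ℝ → ℂ) (ξ : ℝ) : ℂ :=
  (Real.sqrt (2 * Real.pi))⁻¹ • ∫ x : ℝ, Complex.exp (-(Complex.I * ξ * x)) * f x

/-- The inverse Fourier transform with the paper's normalization
`g^∨(x) = (2π)^{−1/2} ∫ e^{iξx} g(ξ) dξ`. -/
noncomputable def invft (g : ℝ → ℂ) (x : ℝ) : ℂ :=
  (Real.sqrt (2 * Real.pi))⁻¹ • ∫ ξ : ℝ, Complex.exp (Complex.I * ξ * x) * g ξ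

open scoped ENNReal

lemma lintegral_mul_le_sqrt_mul_sqrt {α : Type*} [MeasurableSpace α] {μ : Measure α}
    {f g : α → ℝ≥0∞} (hf : AEMeasurable f μ) (hg : AEMeasurable g μ) :
    ∫⁻ x, f x * g x ∂μ ≤
      (∫⁻ x, f x ^ 2 ∂μ) ^ (1 / 2 : ℝ) * (∫⁻ x, g x ^ 2 ∂μ) ^ (1 / 2 : ℝ) := by
  simpa using ENNReal.lintegral_mul_le_Lp_mul_Lq μ Real.HolderConjugate.two_two hf hg

/-- The part `|η| ≤ |ξ|` of a weighted trilinear convolution form on `L²`. -/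
lemma setLIntegral_weighted_convolution_le {a b c w : ℝ → ℝ≥0∞} (ha : Measurable a)
    (hb : Measurable b) (hc : Measurable c) (hw : Measurable w) {K : ℝ≥0∞}
    (hK : ∀ ξ, ∫⁻ η in {η | |η| ≤ |ξ|}, (w ξ * w η) ^ 2 ≤ K) :
    ∫⁻ z in {z : ℝ × ℝ | |z.2| ≤ |z.1|}, a z.1 * b (z.1 - z.2) * c z.2 * (w z.1 * w z.2) ≤
      K ^ (1 / 2 : ℝ) * (∫⁻ x, a x ^ 2) ^ (1 / 2 : ℝ) * (∫⁻ x, b x ^ 2) ^ (1 / 2 : ℝ) *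
        (∫⁻ x, c x ^ 2) ^ (1 / 2 : ℝ) := by
  have hS : MeasurableSet {z : ℝ × ℝ | |z.2| ≤ |z.1|} :=
    measurableSet_le (by fun_prop) (by fun_prop)
  have hbc : ∫⁻ z in {z : ℝ × ℝ | |z.2| ≤ |z.1|}, (b (z.1 - z.2) * c z.2) ^ 2 ≤
      (∫⁻ x, b x ^ 2) * ∫⁻ x, c x ^ 2 := by
    refine (setLIntegral_le_lintegral _ _).trans_eq ?_
    rw [Measure.volume_eq_prod, lintegral_prod_symm _ (by fun_prop)]
    simp_rw [mul_pow]
    rw [← lintegral_const_mul _ (by fun_prop)]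
    refine lintegral_congr fun η => ?_
    rw [lintegral_mul_const _ (by fun_prop),
      lintegral_sub_right_eq_self (fun x => b x ^ 2) η]
  have haw : ∫⁻ z in {z : ℝ × ℝ | |z.2| ≤ |z.1|}, (a z.1 * (w z.1 * w z.2)) ^ 2 ≤
      K * ∫⁻ x, a x ^ 2 := by
    rw [← lintegral_indicator hS, Measure.volume_eq_prod,
      lintegral_prod _ (Measurable.aemeasurable (by
        refine Measurable.indicator ?_ hS
        fun_prop)),
      ← lintegral_const_mul _ (by fun_prop)]
    refine lintegral_mono fun ξ => ?_
    have hSξ : MeasurableSet {η : ℝ | |η| ≤ |ξ|} := measurableSet_le (by fun_prop) (by fun_prop)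
    calc ∫⁻ η, ({z : ℝ × ℝ | |z.2| ≤ |z.1|}.indicator
            (fun z => (a z.1 * (w z.1 * w z.2)) ^ 2) (ξ, η))
        = ∫⁻ η in {η | |η| ≤ |ξ|}, a ξ ^ 2 * (w ξ * w η) ^ 2 := by
          rw [← lintegral_indicator hSξ]
          refine lintegral_congr fun η => ?_
          simp only [Set.indicator_apply, Set.mem_ofPred_eq, mul_pow]
      _ = a ξ ^ 2 * ∫⁻ η in {η | |η| ≤ |ξ|}, (w ξ * w η) ^ 2 :=
          lintegral_const_mul _ (by fun_prop)
      _ ≤ K * a ξ ^ 2 := by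
          rw [mul_comm]
          gcongr
          exact hK ξ
  calc ∫⁻ z in {z : ℝ × ℝ | |z.2| ≤ |z.1|}, a z.1 * b (z.1 - z.2) * c z.2 * (w z.1 * w z.2)
      = ∫⁻ z in {z : ℝ × ℝ | |z.2| ≤ |z.1|},
          (b (z.1 - z.2) * c z.2) * (a z.1 * (w z.1 * w z.2)) :=
        lintegral_congr fun z => by ring
    _ ≤ _ := lintegral_mul_le_sqrt_mul_sqrt (by fun_prop) (by fun_prop)
    _ ≤ ((∫⁻ x, b x ^ 2) * ∫⁻ x, c x ^ 2) ^ (1 / 2 : ℝ) *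
          (K * ∫⁻ x, a x ^ 2) ^ (1 / 2 : ℝ) := by gcongr
    _ = _ := by
        rw [ENNReal.mul_rpow_of_nonneg _ _ (by norm_num),
          ENNReal.mul_rpow_of_nonneg _ _ (by norm_num)]
        ring

/-- A weighted trilinear convolution form is bounded on `L²` under a Schur-type condition on the
weight. -/
lemma lintegral_weighted_convolution_le {a b c w : ℝ → ℝ≥0∞} (ha : Measurable a)
    (hb : Measurable b) (hc : Measurable c) (hw : Measurable w) {K : ℝ≥0∞}
    (hK : ∀ ξ, ∫⁻ η in {η | |η| ≤ |ξ|}, (w ξ * w η) ^ 2 ≤ K) :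
    ∫⁻ z : ℝ × ℝ, a z.1 * b (z.1 - z.2) * c z.2 * (w z.1 * w z.2) ≤
      2 * (K ^ (1 / 2 : ℝ) * (∫⁻ x, a x ^ 2) ^ (1 / 2 : ℝ) * (∫⁻ x, b x ^ 2) ^ (1 / 2 : ℝ) *
        (∫⁻ x, c x ^ 2) ^ (1 / 2 : ℝ)) := by
  set F : ℝ × ℝ → ℝ≥0∞ := fun z => a z.1 * b (z.1 - z.2) * c z.2 * (w z.1 * w z.2)
  have hlow := setLIntegral_weighted_convolution_le ha hb hc hw hK
  have hneg : ∫⁻ x, b (-x) ^ 2 = ∫⁻ x, b x ^ 2 := by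
    simpa using lintegral_sub_left_eq_self (μ := volume) (fun x => b x ^ 2) 0
  have hup := setLIntegral_weighted_convolution_le (b := fun x => b (-x)) hc
    (by fun_prop) ha hw hK
  rw [hneg, Measure.volume_eq_prod, ← (Measure.measurePreserving_swap (μ := (volume : Measure ℝ))
    (ν := (volume : Measure ℝ))).setLIntegral_comp_preimage_emb
    MeasurableEquiv.prodComm.measurableEmbedding] at hup
  have hcover : {z : ℝ × ℝ | |z.2| ≤ |z.1|} ∪
      Prod.swap ⁻¹' {z : ℝ × ℝ | |z.2| ≤ |z.1|} = Set.univ := by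
    ext z
    simpa using le_total |z.2| |z.1|
  calc ∫⁻ z, F z
      = ∫⁻ z in {z : ℝ × ℝ | |z.2| ≤ |z.1|} ∪
          Prod.swap ⁻¹' {z : ℝ × ℝ | |z.2| ≤ |z.1|}, F z := by
        rw [hcover, setLIntegral_univ]
    _ ≤ _ := lintegral_union_le _ _ _
    _ ≤ _ := by
        rw [two_mul]
        refine add_le_add hlow (le_trans (le_of_eq ?_) (hup.trans_eq (by ring)))
        refine lintegral_congr fun z => ?_
        simp only [F, Prod.fst_swap, Prod.snd_swap, neg_sub]
        ring

lemma integral_sq_add_sq_rpow_le {κ r : ℝ} (hκ : 0 < κ) (hr : 0 ≤ r) :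
    ∫ η in (-r)..r, (κ ^ 2 + η ^ 2) ^ (-(1 / 4) : ℝ) ≤ 4 * r ^ (1 / 2 : ℝ) := by
  have hcont : Continuous fun η : ℝ => (κ ^ 2 + η ^ 2) ^ (-(1 / 4) : ℝ) :=
    Continuous.rpow_const (by fun_prop) fun η => Or.inl (by positivity)
  have hhalf : ∫ η in (0 : ℝ)..r, (κ ^ 2 + η ^ 2) ^ (-(1 / 4) : ℝ) ≤ 2 * r ^ (1 / 2 : ℝ) := by
    calc ∫ η in (0 : ℝ)..r, (κ ^ 2 + η ^ 2) ^ (-(1 / 4) : ℝ)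
        ≤ ∫ η in (0 : ℝ)..r, η ^ (-(1 / 2) : ℝ) := by
          refine intervalIntegral.integral_mono_on_of_le_Ioo hr (hcont.intervalIntegrable _ _)
            (intervalIntegral.intervalIntegrable_rpow' (by norm_num)) fun η hη => ?_
          have h : η ^ (-(1 / 2) : ℝ) = (η ^ 2) ^ (-(1 / 4) : ℝ) := by
            rw [← Real.rpow_natCast, ← Real.rpow_mul hη.1.le]
            norm_num
          rw [h]
          exact Real.rpow_le_rpow_of_nonpos (by have := hη.1; positivity)
            (by nlinarith) (by norm_num)
      _ = 2 * r ^ (1 / 2 : ℝ) := by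
          rw [integral_rpow (Or.inl (by norm_num))]
          norm_num
          ring
  have hneg : ∫ η in (-r)..0, (κ ^ 2 + η ^ 2) ^ (-(1 / 4) : ℝ) =
      ∫ η in (0 : ℝ)..r, (κ ^ 2 + η ^ 2) ^ (-(1 / 4) : ℝ) := by
    have h := intervalIntegral.integral_comp_neg (a := 0) (b := r)
      (fun η : ℝ => ((κ ^ 2 + η ^ 2) ^ (-(1 / 4) : ℝ) : ℝ))
    simp only [neg_sq, neg_zero] at h
    exact h.symm
  rw [← intervalIntegral.integral_add_adjacent_intervals (hcont.intervalIntegrable _ 0)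
    (hcont.intervalIntegrable _ _), hneg]
  linarith

lemma lintegral_sq_add_sq_rpow_le {κ : ℝ} (hκ : 0 < κ) (ξ : ℝ) :
    ∫⁻ η in {η | |η| ≤ |ξ|}, (ENNReal.ofReal ((κ ^ 2 + ξ ^ 2) ^ (-(1 / 8) : ℝ)) *
      ENNReal.ofReal ((κ ^ 2 + η ^ 2) ^ (-(1 / 8) : ℝ))) ^ 2 ≤ 4 := by
  have hsq (x : ℝ) : ((κ ^ 2 + x ^ 2) ^ (-(1 / 8) : ℝ)) ^ 2 =
      (κ ^ 2 + x ^ 2) ^ (-(1 / 4) : ℝ) := by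
    rw [← Real.rpow_natCast, ← Real.rpow_mul (by positivity)]
    norm_num
  have hcont : Continuous fun η : ℝ => (κ ^ 2 + η ^ 2) ^ (-(1 / 4) : ℝ) :=
    Continuous.rpow_const (by fun_prop) fun η => Or.inl (by positivity)
  have hset : {η : ℝ | |η| ≤ |ξ|} = Set.Icc (-|ξ|) |ξ| := by
    ext η
    simp [abs_le]
  have hpt (η : ℝ) : (ENNReal.ofReal ((κ ^ 2 + ξ ^ 2) ^ (-(1 / 8) : ℝ)) *
      ENNReal.ofReal ((κ ^ 2 + η ^ 2) ^ (-(1 / 8) : ℝ))) ^ 2 =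
      ENNReal.ofReal ((κ ^ 2 + ξ ^ 2) ^ (-(1 / 4) : ℝ)) *
        ENNReal.ofReal ((κ ^ 2 + η ^ 2) ^ (-(1 / 4) : ℝ)) := by
    rw [mul_pow, ← ENNReal.ofReal_pow (by positivity), ← ENNReal.ofReal_pow (by positivity),
      hsq, hsq]
  simp_rw [hpt]
  rw [lintegral_const_mul _ (by fun_prop), hset,
    ← ofReal_integral_eq_lintegral_ofReal hcont.continuousOn.integrableOn_Icc
      (.of_forall fun η => by positivity),
    ← ENNReal.ofReal_mul (by positivity), integral_Icc_eq_integral_Ioc,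
    ← intervalIntegral.integral_of_le (by linarith [abs_nonneg ξ])]
  refine ENNReal.ofReal_le_of_le_toReal ?_
  rw [ENNReal.toReal_ofNat]
  have hroot : |ξ| ^ (1 / 2 : ℝ) ≤ (κ ^ 2 + ξ ^ 2) ^ (1 / 4 : ℝ) := by
    have h : |ξ| ^ (1 / 2 : ℝ) = (ξ ^ 2) ^ (1 / 4 : ℝ) := by
      rw [← sq_abs, ← Real.rpow_natCast, ← Real.rpow_mul (abs_nonneg ξ)]
      norm_num
    rw [h]
    exact Real.rpow_le_rpow (by positivity) (by nlinarith) (by norm_num)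
  calc (κ ^ 2 + ξ ^ 2) ^ (-(1 / 4) : ℝ) *
        ∫ η in (-|ξ|)..|ξ|, (κ ^ 2 + η ^ 2) ^ (-(1 / 4) : ℝ)
      ≤ (κ ^ 2 + ξ ^ 2) ^ (-(1 / 4) : ℝ) * (4 * (κ ^ 2 + ξ ^ 2) ^ (1 / 4 : ℝ)) := by
        gcongr
        exact (integral_sq_add_sq_rpow_le hκ (abs_nonneg ξ)).trans (by linarith)
    _ = 4 := by
        rw [Real.rpow_neg (by positivity)]
        field_simp

lemma ft_eq_fourier (f : SchwartzMap ℝ ℂ) (ξ : ℝ) :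
    ft f ξ = (Real.sqrt (2 * Real.pi))⁻¹ •
      (FourierTransform.fourier f : SchwartzMap ℝ ℂ) (ξ / (2 * Real.pi)) := by
  rw [ft, SchwartzMap.fourier_coe, Real.fourier_real_eq_integral_exp_smul]
  congr 1
  refine integral_congr_ae (.of_forall fun x => ?_)
  simp only [smul_eq_mul]
  congr 2
  push_cast
  have : (Real.pi : ℂ) ≠ 0 := by exact_mod_cast Real.pi_ne_zero
  field_simp

lemma continuous_ft (f : SchwartzMap ℝ ℂ) : Continuous (ft f) := by
  rw [funext (ft_eq_fourier f)]
  fun_prop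

lemma integrable_ft (f : SchwartzMap ℝ ℂ) : Integrable (ft f) := by
  rw [funext (ft_eq_fourier f)]
  exact ((FourierTransform.fourier f : SchwartzMap ℝ ℂ).integrable.comp_div
    Real.two_pi_pos.ne').smul (Real.sqrt (2 * Real.pi))⁻¹

lemma integral_norm_sq_ft (f : SchwartzMap ℝ ℂ) : ∫ ξ, ‖ft f ξ‖ ^ 2 = ∫ x, ‖f x‖ ^ 2 := by
  simp_rw [ft_eq_fourier, norm_smul, mul_pow]
  rw [integral_const_mul, Measure.integral_comp_div
    (fun x => ‖(FourierTransform.fourier f : SchwartzMap ℝ ℂ) x‖ ^ 2),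
    SchwartzMap.integral_norm_sq_fourier, norm_inv, inv_pow, Real.norm_of_nonneg (by positivity),
    Real.sq_sqrt (by positivity), abs_of_pos (by positivity), smul_eq_mul]
  field_simp

lemma lintegral_enorm_sq_ft (f : SchwartzMap ℝ ℂ) :
    ∫⁻ ξ, ‖ft f ξ‖ₑ ^ 2 = ENNReal.ofReal (∫ x, ‖f x‖ ^ 2) := by
  have h_int : Integrable fun ξ => ‖ft f ξ‖ ^ 2 := by
    have h := ((FourierTransform.fourier f : SchwartzMap ℝ ℂ).memLp 2).integrable_norm_pow
      (by norm_num)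
    have h' := (h.comp_div Real.two_pi_pos.ne').const_mul
      (‖(Real.sqrt (2 * Real.pi))⁻¹‖ ^ 2)
    simp_rw [ft_eq_fourier, norm_smul, mul_pow]
    simpa using h'
  rw [← integral_norm_sq_ft, ofReal_integral_eq_lintegral_ofReal h_int
    (.of_forall fun ξ => by positivity)]
  refine lintegral_congr fun ξ => ?_
  rw [ENNReal.ofReal_pow (norm_nonneg _), ofReal_norm]

lemma integral_conj_invft_mul_mul_invft {Φ Ψ q : ℝ → ℂ} (hΦ : Integrable Φ) (hΨ : Integrable Ψ)
    (hq : Integrable q) :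
    ∫ x, (starRingEnd ℂ) (invft Φ x) * q x * invft Ψ x =
      (Real.sqrt (2 * Real.pi))⁻¹ •
        ∫ z : ℝ × ℝ, (starRingEnd ℂ) (Φ z.1) * ft q (z.1 - z.2) * Ψ z.2 := by
  set s : ℝ := (Real.sqrt (2 * Real.pi))⁻¹
  have hΦ' : Integrable fun ξ => (starRingEnd ℂ) (Φ ξ) :=
    (Complex.conjLIE.toContinuousLinearEquiv.integrable_comp_iff).2 hΦ
  have hprod (x : ℝ) : (starRingEnd ℂ) (invft Φ x) * q x * invft Ψ x =
      s • s • ∫ z : ℝ × ℝ, Complex.exp (-(Complex.I * (z.1 - z.2 : ℝ) * x)) * q x *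
        ((starRingEnd ℂ) (Φ z.1) * Ψ z.2) := by
    have h : ∀ z : ℝ × ℝ, Complex.exp (-(Complex.I * (z.1 - z.2 : ℝ) * x)) * q x *
        ((starRingEnd ℂ) (Φ z.1) * Ψ z.2) =
        q x * ((starRingEnd ℂ) (Complex.exp (Complex.I * z.1 * x) * Φ z.1) *
          (Complex.exp (Complex.I * z.2 * x) * Ψ z.2)) := fun z => by
      have he : Complex.exp (-(Complex.I * (z.1 - z.2 : ℝ) * x)) =
          (starRingEnd ℂ) (Complex.exp (Complex.I * z.1 * x)) *
            Complex.exp (Complex.I * z.2 * x) := by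
        rw [← Complex.exp_conj, ← Complex.exp_add]
        congr 1
        simp
        ring
      rw [he, map_mul]
      ring
    simp_rw [h]
    rw [integral_const_mul, Measure.volume_eq_prod,
      integral_prod_mul (fun ξ : ℝ => (starRingEnd ℂ) (Complex.exp (Complex.I * ξ * x) * Φ ξ))
        (fun η : ℝ => Complex.exp (Complex.I * η * x) * Ψ η), integral_conj]
    simp only [invft, Complex.real_smul, map_mul, Complex.conj_ofReal]
    ring
  simp_rw [hprod]
  rw [integral_smul, integral_smul]
  congr 1
  rw [integral_integral_swap, ← integral_smul]
  · refine integral_congr_ae (.of_forall fun z => ?_)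
    simp only [ft, integral_mul_const, Complex.real_smul]
    ring
  · have hmain : Integrable (fun p : ℝ × (ℝ × ℝ) =>
        q p.1 * ((starRingEnd ℂ) (Φ p.2.1) * Ψ p.2.2)) (volume.prod volume) :=
      hq.mul_prod (hΦ'.mul_prod hΨ)
    have hbdd := hmain.bdd_mul (c := 1)
      (f := fun p : ℝ × (ℝ × ℝ) => Complex.exp (-(Complex.I * (p.2.1 - p.2.2 : ℝ) * p.1)))
      (by fun_prop) (.of_forall fun p => by rw [Complex.norm_exp]; simp)
    refine hbdd.congr (.of_forall fun p => ?_)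
    simp only [Function.uncurry]
    ring

/-- Estimate (2.7) of Lemma 2.5 of the paper, in bilinear-form version:
`‖(κ−∂)^{−1/4} q (κ+∂)^{−1/4}‖_op ≲ ‖q‖_{L²}`. -/
theorem quarter_power_operator_bound :
    ∃ C : ℝ, 0 < C ∧ ∀ κ : ℝ, 1 ≤ κ → ∀ q f g : SchwartzMap ℝ ℂ,
      ‖∫ x : ℝ,
          (starRingEnd ℂ)
              (invft (fun ξ => ((κ ^ 2 + ξ ^ 2) ^ (-(1 / 8) : ℝ) : ℝ) • ft (⇑f) ξ) x) *
            q x *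
            invft (fun ξ => ((κ ^ 2 + ξ ^ 2) ^ (-(1 / 8) : ℝ) : ℝ) • ft (⇑g) ξ) x‖
        ≤ C * Real.sqrt (∫ x : ℝ, ‖q x‖ ^ 2) * Real.sqrt (∫ x : ℝ, ‖f x‖ ^ 2) *
            Real.sqrt (∫ x : ℝ, ‖g x‖ ^ 2) := by
  refine ⟨4, by norm_num, fun κ hκ q f g => ?_⟩
  have hκ0 : 0 < κ := by linarith
  set w : ℝ → ℝ := fun ξ => (κ ^ 2 + ξ ^ 2) ^ (-(1 / 8) : ℝ)
  have hw_nonneg (ξ : ℝ) : 0 ≤ w ξ := by positivity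
  have hw_cont : Continuous w :=
    Continuous.rpow_const (by fun_prop) fun ξ => Or.inl (by positivity)
  have hw_le (ξ : ℝ) : ‖w ξ‖ ≤ 1 := by
    rw [Real.norm_of_nonneg (hw_nonneg ξ)]
    exact Real.rpow_le_one_of_one_le_of_nonpos (by nlinarith [sq_nonneg ξ]) (by norm_num)
  have h_int (h : SchwartzMap ℝ ℂ) : Integrable fun ξ => w ξ • ft h ξ :=
    (integrable_ft h).bdd_smul 1 hw_cont.aestronglyMeasurable (.of_forall hw_le)
  rw [integral_conj_invft_mul_mul_invft (h_int f) (h_int g) q.integrable, norm_smul]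
  have hs : ‖(Real.sqrt (2 * Real.pi))⁻¹‖ ≤ 1 := by
    rw [Real.norm_of_nonneg (by positivity)]
    refine inv_le_one_of_one_le₀ (Real.one_le_sqrt.2 ?_)
    linarith [Real.pi_gt_three]
  refine (mul_le_of_le_one_left (norm_nonneg _) hs).trans ?_
  have hmeas (h : SchwartzMap ℝ ℂ) : Measurable fun ξ => ‖ft h ξ‖ₑ :=
    (continuous_ft h).measurable.enorm
  have hbound := lintegral_weighted_convolution_le (hmeas f) (hmeas q) (hmeas g)
    (w := fun ξ => ENNReal.ofReal (w ξ)) (by fun_prop) (lintegral_sq_add_sq_rpow_le hκ0)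
  simp_rw [lintegral_enorm_sq_ft] at hbound
  have hfour : (4 : ℝ≥0∞) ^ (1 / 2 : ℝ) = ENNReal.ofReal 2 := by
    rw [show (4 : ℝ≥0∞) = ENNReal.ofReal 4 by simp,
      ENNReal.ofReal_rpow_of_nonneg (by norm_num) (by norm_num), ← Real.sqrt_eq_rpow,
      show (4 : ℝ) = 2 ^ 2 by norm_num, Real.sqrt_sq (by norm_num)]
  have hsqrt (h : SchwartzMap ℝ ℂ) : ENNReal.ofReal (∫ x, ‖h x‖ ^ 2) ^ (1 / 2 : ℝ) =
      ENNReal.ofReal (Real.sqrt (∫ x, ‖h x‖ ^ 2)) := by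
    rw [ENNReal.ofReal_rpow_of_nonneg (integral_nonneg fun x => by positivity) (by norm_num),
      ← Real.sqrt_eq_rpow]
  rw [hfour, hsqrt, hsqrt, hsqrt, ← ENNReal.ofReal_mul (by positivity),
    ← ENNReal.ofReal_mul (by positivity), ← ENNReal.ofReal_mul (by positivity),
    show (2 : ℝ≥0∞) = ENNReal.ofReal 2 by simp, ← ENNReal.ofReal_mul (by positivity)] at hbound
  rw [← ENNReal.ofReal_le_ofReal_iff (by positivity), ofReal_norm]
  refine (enorm_integral_le_lintegral_enorm _).trans (le_trans (le_of_eq ?_)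
    (hbound.trans_eq (by congr 1; ring)))
  refine lintegral_congr fun z => ?_
  simp only [enorm_mul, enorm_smul, RCLike.enorm_conj, Real.enorm_of_nonneg (hw_nonneg _)]
  ring
end

section
/- Let s be a finite index set and λ : s → ℂ a family of complex numbers. Then |∏_{i∈s} (1+λᵢ) − exp(∑_{i∈s} λᵢ)| ≤ (1/2)·(∑_{i∈s} |λᵢ|²)·exp(∑_{i∈s} |λᵢ|). -/
theorem Real.exp_sub_one_sub_id_le_sq_div_two_mul_exp {r : ℝ} (hr : 0 ≤ r) :
    Real.exp r - 1 - r ≤ 1 / 2 * r ^ 2 * Real.exp r := by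
  have hderiv (x : ℝ) : HasDerivAt (fun x : ℝ => Real.exp (-x) * (1 + x) + x ^ 2 / 2)
      (x * (1 - Real.exp (-x))) x := by
    refine ((((hasDerivAt_neg x).exp.mul ((hasDerivAt_id x).const_add 1)).add
      ((hasDerivAt_pow 2 x).div_const 2))).congr_deriv ?_
    simp only [id_eq, Nat.cast_ofNat, Nat.add_one_sub_one, pow_one]
    ring
  have hmono : Monotone (fun x : ℝ => Real.exp (-x) * (1 + x) + x ^ 2 / 2) := by
    refine monotone_of_hasDerivAt_nonneg hderiv fun x => ?_
    rcases le_total 0 x with hx | hx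
    · exact mul_nonneg hx (sub_nonneg.2 (Real.exp_le_one_iff.2 (neg_nonpos.2 hx)))
    · exact mul_nonneg_of_nonpos_of_nonpos hx
        (sub_nonpos.2 (Real.one_le_exp (neg_nonneg.2 hx)))
  have h := hmono hr
  have hexp : Real.exp (-r) * Real.exp r = 1 := by rw [← Real.exp_add]; simp
  norm_num at h
  have h' := mul_le_mul_of_nonneg_right h (Real.exp_pos r).le
  linear_combination h' + (1 + r) * hexp

theorem Complex.norm_one_add_sub_exp_le (z : ℂ) :
    ‖1 + z - Complex.exp z‖ ≤ 1 / 2 * ‖z‖ ^ 2 * Real.exp ‖z‖ := by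
  have h := Complex.norm_exp_sub_sum_le_exp_norm_sub_sum z 2
  simp only [Finset.sum_range_succ, Finset.sum_range_zero, pow_zero, pow_one, Nat.factorial,
    Nat.cast_one, div_one, zero_add, mul_one] at h
  rw [norm_sub_rev]
  refine h.trans ?_
  rw [← sub_sub]
  exact Real.exp_sub_one_sub_id_le_sq_div_two_mul_exp (norm_nonneg z)

theorem norm_prod_one_add_le_exp_sum_norm {ι : Type*} (s : Finset ι) (f : ι → ℂ) :
    ‖∏ i ∈ s, (1 + f i)‖ ≤ Real.exp (∑ i ∈ s, ‖f i‖) := by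
  rw [norm_prod, Real.exp_sum]
  refine Finset.prod_le_prod (fun i _ => norm_nonneg _) fun i _ => ?_
  calc ‖1 + f i‖ ≤ ‖(1 : ℂ)‖ + ‖f i‖ := norm_add_le _ _
    _ = ‖f i‖ + 1 := by rw [norm_one, add_comm]
    _ ≤ Real.exp ‖f i‖ := Real.add_one_le_exp _

/-- The combinatorial core of Lemma 3.4 of the paper:
`|∏(1+λᵢ) − exp(∑λᵢ)| ≤ ½ (∑|λᵢ|²) exp(∑|λᵢ|)`. -/
theorem prod_sub_exp_sum_bound {ι : Type*} (s : Finset ι) (lam : ι → ℂ) :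
    ‖(∏ i ∈ s, (1 + lam i)) - Complex.exp (∑ i ∈ s, lam i)‖ ≤
      (1 / 2) * (∑ i ∈ s, ‖lam i‖ ^ 2) * Real.exp (∑ i ∈ s, ‖lam i‖) := by
  induction s using Finset.cons_induction with
  | empty => simp
  | cons a s ha ih =>
    simp only [Finset.prod_cons, Finset.sum_cons, Complex.exp_add, Real.exp_add]
    calc ‖(1 + lam a) * ∏ i ∈ s, (1 + lam i)
            - Complex.exp (lam a) * Complex.exp (∑ i ∈ s, lam i)‖
        = ‖(1 + lam a - Complex.exp (lam a)) * ∏ i ∈ s, (1 + lam i)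
            + Complex.exp (lam a)
              * ((∏ i ∈ s, (1 + lam i)) - Complex.exp (∑ i ∈ s, lam i))‖ := by
          congr 1; ring
      _ ≤ ‖1 + lam a - Complex.exp (lam a)‖ * ‖∏ i ∈ s, (1 + lam i)‖
            + ‖Complex.exp (lam a)‖
              * ‖(∏ i ∈ s, (1 + lam i)) - Complex.exp (∑ i ∈ s, lam i)‖ := by
          simpa only [norm_mul] using norm_add_le
            ((1 + lam a - Complex.exp (lam a)) * ∏ i ∈ s, (1 + lam i)) (Complex.exp (lam a)
              * ((∏ i ∈ s, (1 + lam i)) - Complex.exp (∑ i ∈ s, lam i)))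
      _ ≤ (1 / 2 * ‖lam a‖ ^ 2 * Real.exp ‖lam a‖) * Real.exp (∑ i ∈ s, ‖lam i‖)
            + Real.exp ‖lam a‖
              * ((1 / 2) * (∑ i ∈ s, ‖lam i‖ ^ 2) * Real.exp (∑ i ∈ s, ‖lam i‖)) := by
          gcongr
          · exact Complex.norm_one_add_sub_exp_le _
          · exact norm_prod_one_add_le_exp_sum_norm s lam
          · exact Complex.norm_exp_le_exp_norm _
      _ = _ := by ring
end

section
/- Let C > 0 and 0 < ε < π, and let R = {z ∈ ℂ : |Re z| ≤ C and 0 < Im z < 2π − ε}. Then for all z, w ∈ R, |Im(z − w)| ≤ (π·e^C / sin(ε/2))·|e^w − e^z|. -/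
theorem Complex.two_mul_exp_mul_abs_sin_le_norm_exp_sub_exp (z w : ℂ) :
    2 * Real.exp ((z.re + w.re) / 2) * |Real.sin ((z.im - w.im) / 2)| ≤
      ‖Complex.exp z - Complex.exp w‖ := by
  refine (abs_le_of_sq_le_sq' ?_ (norm_nonneg _)).2
  have hexp : Real.exp ((z.re + w.re) / 2) ^ 2 = Real.exp z.re * Real.exp w.re := by
    rw [← Real.exp_nat_mul, ← Real.exp_add]
    congr 1
    push_cast
    ring
  have hsin : 2 * Real.sin ((z.im - w.im) / 2) ^ 2 =
      1 - (Real.cos z.im * Real.cos w.im + Real.sin z.im * Real.sin w.im) := by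
    rw [← Real.cos_sub, Real.sin_sq_eq_half_sub, mul_div_cancel₀ _ (two_ne_zero' ℝ)]
    ring
  rw [Complex.sq_norm, Complex.normSq_apply, mul_pow, mul_pow, sq_abs, hexp]
  simp only [Complex.sub_re, Complex.sub_im, Complex.exp_re, Complex.exp_im]
  linear_combination sq_nonneg (Real.exp z.re - Real.exp w.re) +
    2 * Real.exp z.re * Real.exp w.re * hsin -
    Real.exp z.re ^ 2 * Real.sin_sq_add_cos_sq z.im -
    Real.exp w.re ^ 2 * Real.sin_sq_add_cos_sq w.im

theorem Real.mul_sin_le_pi_mul_sin {x δ : ℝ} (hx : 0 ≤ x) (hδ : 0 ≤ δ) (hxδ : x ≤ Real.pi - δ) :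
    x * sin δ ≤ Real.pi * sin x := by
  rcases le_total x (Real.pi / 2) with h | h
  · have hsin : 2 / Real.pi * x ≤ sin x := mul_le_sin hx h
    have hx' : 2 * x ≤ Real.pi * sin x := by
      calc 2 * x = Real.pi * (2 / Real.pi * x) := by field_simp
        _ ≤ Real.pi * sin x := by gcongr
    nlinarith [sin_le_one δ]
  · have hsin : sin δ ≤ sin x := by
      rw [← sin_pi_sub x]
      exact sin_le_sin_of_le_of_le_pi_div_two (by linarith [pi_pos]) (by linarith) (by linarith)
    have hsin_nonneg : 0 ≤ sin δ := sin_nonneg_of_nonneg_of_le_pi hδ (by linarith)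
    exact mul_le_mul (by linarith) hsin hsin_nonneg pi_pos.le

/-- Lemma 3.5 of the paper: on the rectangle
`R = {z : |Re z| ≤ C, 0 < Im z < 2π − ε}` one can invert the exponential:
`|Im(z−w)| ≤ (π e^C / sin(ε/2)) |e^w − e^z|`. -/
theorem unwrap_exponential (C ε : ℝ) (hC : 0 < C) (hε : 0 < ε) (hεπ : ε < Real.pi)
    (z w : ℂ)
    (hz : |z.re| ≤ C ∧ 0 < z.im ∧ z.im < 2 * Real.pi - ε)
    (hw : |w.re| ≤ C ∧ 0 < w.im ∧ w.im < 2 * Real.pi - ε) :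
    |(z - w).im| ≤ (Real.pi * Real.exp C / Real.sin (ε / 2)) *
      ‖Complex.exp w - Complex.exp z‖ := by
  have him : |(z - w).im| < 2 * Real.pi - ε := by
    rw [Complex.sub_im, abs_lt]
    constructor <;> linarith [hz.2.1, hz.2.2, hw.2.1, hw.2.2]
  have hsin_pos : 0 < Real.sin (ε / 2) := Real.sin_pos_of_pos_of_lt_pi (by linarith) (by linarith)
  have hangle : |(z - w).im| / 2 * Real.sin (ε / 2) ≤
      Real.pi * |Real.sin ((w.im - z.im) / 2)| := by
    calc |(z - w).im| / 2 * Real.sin (ε / 2)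
        ≤ Real.pi * Real.sin (|(z - w).im| / 2) :=
          Real.mul_sin_le_pi_mul_sin (by positivity) (by linarith) (by linarith)
      _ ≤ Real.pi * |Real.sin ((w.im - z.im) / 2)| := by
          gcongr
          rw [Complex.sub_im, abs_sub_comm]
          rcases abs_choice (w.im - z.im) with h | h <;> rw [h]
          · exact le_abs_self _
          · rw [neg_div, Real.sin_neg]
            exact neg_le_abs _
  have hexp : 1 ≤ Real.exp C * Real.exp ((w.re + z.re) / 2) := by
    rw [← Real.exp_add]
    exact Real.one_le_exp (by linarith [neg_le_of_abs_le hz.1, neg_le_of_abs_le hw.1])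
  rw [div_mul_eq_mul_div, le_div_iff₀ hsin_pos]
  calc |(z - w).im| * Real.sin (ε / 2)
      ≤ 1 * (2 * (Real.pi * |Real.sin ((w.im - z.im) / 2)|)) := by linarith
    _ ≤ Real.exp C * Real.exp ((w.re + z.re) / 2) *
          (2 * (Real.pi * |Real.sin ((w.im - z.im) / 2)|)) := by gcongr
    _ = Real.pi * Real.exp C *
          (2 * Real.exp ((w.re + z.re) / 2) * |Real.sin ((w.im - z.im) / 2)|) := by ring
    _ ≤ Real.pi * Real.exp C * ‖Complex.exp w - Complex.exp z‖ := by
        gcongr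
        exact Complex.two_mul_exp_mul_abs_sin_le_norm_exp_sub_exp w z
end
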